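/- Let c₁, c₂, c₃, c₄ > 0, and let C > 0 be a constant for which the Christoffel lower bound holds (i.e., there is c₀ > 0 with Σ_{j<m} ψ_j(x)² ≥ c₀√m whenever |x| ≤ C√m). Let m ≥ n ≥ 1 be integers with C² m ≥ 4 n, and let ν be a positive measure in SMZ(m) with constants (c₁,c₂,c₃,c₄). Then there exists a constant c > 0, depending only on (c₁,c₂,c₃,c₄), C and c₀, such that for every x ∈ ℝ: (i) ∫ |K_n(ν;x,y)| dν(y) ≤ c n^{1/2}; (ii) ∫ |K_n(x,y)| dν(y) ≤ c n^{1/2}, where K_n(x,y) = Σ_{k<n} ψ_k(x)ψ_k(y); (iii) ∫ |K̂_n(ν;x,y)| dν(y) ≤ c n^{1/2}; and (iv) ∫_ℝ |K̂_n(ν;x,y)| dy ≤ c n^{1/2}. -/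

import Mathlib

open MeasureTheory Filter ENNReal ProbabilityTheory

noncomputable def psiH (k : ℕ) (x : ℝ) : ℝ :=
  (Real.sqrt Real.pi * 2 ^ k * (Nat.factorial k : ℝ)) ^ (-(1 : ℝ) / 2) * (-1 : ℝ) ^ k *
    Real.exp (x ^ 2 / 2) * iteratedDeriv k (fun t : ℝ => Real.exp (-t ^ 2)) x

noncomputable def PiH (n : ℕ) : Submodule ℝ (ℝ → ℝ) :=
  Submodule.span ℝ {f : ℝ → ℝ | ∃ k, k < n ∧ f = psiH k}

noncomputable def degApproxH (p : ℝ≥0∞) (n : ℕ) (f : ℝ → ℝ) : ℝ≥0∞ :=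
  ⨅ (P : ℝ → ℝ) (_ : P ∈ PiH n), eLpNorm (fun x => f x - P x) p volume

noncomputable def fourierT (f : ℝ → ℝ) (ω : ℝ) : ℂ :=
  (Real.sqrt (2 * Real.pi) : ℂ)⁻¹ * ∫ t : ℝ, (f t : ℂ) * Complex.exp (-(Complex.I * ω * t))

def SMZ (m : ℕ) (c₁ c₂ c₃ c₄ : ℝ) (ν : Measure ℝ) : Prop :=
  (∀ P ∈ PiH m,
      ENNReal.ofReal c₁ * (∫⁻ t : ℝ, ENNReal.ofReal (P t ^ 2)) ≤ (∫⁻ t, ENNReal.ofReal (P t ^ 2) ∂ν) ∧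
      (∫⁻ t, ENNReal.ofReal (P t ^ 2) ∂ν) ≤ ENNReal.ofReal c₂ * (∫⁻ t : ℝ, ENNReal.ofReal (P t ^ 2))) ∧
  ENNReal.ofReal (c₃ * Real.sqrt m) ≤ ν Set.univ ∧ ν Set.univ ≤ ENNReal.ofReal (c₄ * Real.sqrt m)

open Polynomial in
lemma C2 : (C (2:ℝ)) = 2 := map_ofNat C 2

open Polynomial in
noncomputable def hP : ℕ → ℝ[X]
  | 0 => 1
  | (k+1) => 2 * X * hP k - derivative (hP k)

noncomputable def gK (k : ℕ) : ℝ := Real.sqrt Real.pi * 2 ^ k * (Nat.factorial k : ℝ)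

lemma gK_pos (k : ℕ) : 0 < gK k := by unfold gK; positivity

open Polynomial in
noncomputable def W (p : ℝ[X]) (x : ℝ) : ℝ := p.eval x * Real.exp (-x ^ 2 / 2)

open Polynomial in
lemma hP_deriv (k : ℕ) : derivative (hP (k+1)) = (2 * ((k:ℝ[X]) + 1)) * hP k := by
  induction k with
  | zero => simp [hP]
  | succ k ih =>
    rw [hP, derivative_sub, derivative_mul, ih]
    have : derivative (2 * (X : ℝ[X])) = 2 := by simp
    rw [this, derivative_mul]
    have h2 : derivative (2 * ((k:ℝ[X]) + 1)) = 0 := by simp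
    rw [h2]
    conv_lhs => rw [hP]
    conv_rhs => rw [hP]
    push_cast
    ring

lemma iter_gauss (k : ℕ) : iteratedDeriv k (fun t : ℝ => Real.exp (-t ^ 2)) =
    fun x => (-1) ^ k * (hP k).eval x * Real.exp (-x ^ 2) := by
  induction k with
  | zero => ext x; simp [hP]
  | succ k ih =>
    rw [iteratedDeriv_succ, ih]
    ext x
    have h1 : HasDerivAt (fun x : ℝ => Real.exp (-x ^ 2)) (Real.exp (-x ^ 2) * (-(2 * x))) x := by
      have := ((hasDerivAt_pow 2 x).neg).exp
      simpa using this
    have h2 := (((hP k).hasDerivAt x).const_mul ((-1 : ℝ) ^ k)).mul h1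
    refine h2.deriv.trans ?_
    simp [hP]
    ring

noncomputable def gam (k : ℕ) : ℝ := (gK k) ^ (-(1 : ℝ) / 2)

lemma gam_sq (k : ℕ) : gam k ^ 2 * gK k = 1 := by
  unfold gam
  have := gK_pos k
  rw [← Real.rpow_natCast, ← Real.rpow_mul this.le]
  norm_num
  rw [Real.rpow_neg_one, inv_mul_cancel₀ this.ne']

lemma psiH_eq (k : ℕ) : psiH k = W (Polynomial.C (gam k) * hP k) := by
  ext x
  unfold psiH W
  rw [iter_gauss]
  have h : Real.exp (-x^2/2) = Real.exp (x^2/2) * Real.exp (-x^2) := by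
    rw [← Real.exp_add]; ring_nf
  rw [h]
  have h1 : ((-1:ℝ))^k * (-1)^k = 1 := by rw [← mul_pow]; norm_num
  simp only [Polynomial.eval_mul, Polynomial.eval_C, gam, gK]
  linear_combination ((√Real.pi * 2 ^ k * (Nat.factorial k:ℝ)) ^ (-(1:ℝ) / 2) * Real.exp (x ^ 2 / 2) * (hP k).eval x * Real.exp (-x ^ 2)) * h1

open Polynomial in
lemma integrable_poly (p : ℝ[X]) : Integrable (fun x : ℝ => p.eval x * Real.exp (-x ^ 2)) := by
  induction p using Polynomial.induction_on' with
  | add p q hp hq => simpa [add_mul] using hp.fun_add hq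
  | monomial k a =>
    have := (integrable_rpow_mul_exp_neg_mul_sq (b := 1) one_pos (s := (k:ℝ)) (by
      have : (0:ℝ) ≤ k := by positivity
      linarith)).const_mul a
    simpa [Real.rpow_natCast, mul_assoc] using this

open Polynomial in
noncomputable def I : ℝ[X] →ₗ[ℝ] ℝ where
  toFun p := ∫ x : ℝ, p.eval x * Real.exp (-x ^ 2)
  map_add' p q := by
    rw [← integral_add (integrable_poly p) (integrable_poly q)]
    simp [add_mul]
  map_smul' c p := by
    simp [mul_assoc, integral_const_mul]

open Polynomial in
lemma I_apply (p : ℝ[X]) : I p = ∫ x : ℝ, p.eval x * Real.exp (-x ^ 2) := rfl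

open Polynomial in
lemma I_parts (p : ℝ[X]) : I (derivative p - 2 * X * p) = 0 := by
  rw [I_apply]
  refine integral_eq_zero_of_hasDerivAt_of_integrable (f := fun x => p.eval x * Real.exp (-x ^ 2)) ?_ (integrable_poly _) (integrable_poly p)
  intro x
  have h1 : HasDerivAt (fun x : ℝ => Real.exp (-x ^ 2)) (Real.exp (-x ^ 2) * (-(2 * x))) x := by
    have := ((hasDerivAt_pow 2 x).neg).exp
    simpa using this
  refine HasDerivAt.congr_deriv ((p.hasDerivAt x).mul h1) ?_
  simp
  ring

open Polynomial in
lemma I_shift (k : ℕ) (s : ℝ[X]) : I (hP (k+1) * s) = I (hP k * derivative s) := by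
  have := I_parts (hP k * s)
  rw [← sub_eq_zero, ← map_sub, ← neg_eq_zero, ← map_neg]
  convert this using 2
  rw [hP, derivative_mul]; ring

open Polynomial in
lemma I_orth (k : ℕ) : ∀ j, I (hP k * hP j) = if k = j then gK k else 0 := by
  induction k with
  | zero =>
    intro j
    cases j with
    | zero =>
      simp [hP, gK, I_apply]
      simpa using integral_gaussian 1
    | succ j =>
      rw [mul_comm, I_shift]; simp [hP]
  | succ k ih =>
    intro j
    rw [I_shift]
    cases j with
    | zero => simp [hP]
    | succ j =>
      rw [hP_deriv]
      have : hP k * (2 * ((j:ℝ[X]) + 1) * hP j) = (2 * ((j:ℝ) + 1)) • (hP k * hP j) := by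
        rw [smul_eq_C_mul]; simp [C2]; ring
      rw [this, map_smul, ih]
      by_cases h : k = j
      · subst h
        simp [gK, Nat.factorial_succ, pow_succ]; ring
      · simp [h]

lemma W_mul (p q : Polynomial ℝ) (x : ℝ) : W p x * W q x = (p * q).eval x * Real.exp (-x ^ 2) := by
  have h : Real.exp (-x^2) = Real.exp (-x^2/2) * Real.exp (-x^2/2) := by
    rw [← Real.exp_add]; ring_nf
  rw [h]; simp [W]; ring

lemma W_mul_int (p q : Polynomial ℝ) : Integrable (fun x => W p x * W q x) := by
  simp_rw [W_mul]; exact integrable_poly _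

lemma I_W (p q : Polynomial ℝ) : ∫ x, W p x * W q x = I (p * q) := by
  simp_rw [W_mul]; rfl

open Polynomial in
lemma W_deriv (p : ℝ[X]) (x : ℝ) : HasDerivAt (W p) (W (derivative p - X * p) x) x := by
  have h1 : HasDerivAt (fun x : ℝ => Real.exp (-x ^ 2 / 2)) (Real.exp (-x ^ 2/2) * (-x)) x := by
    have := (((hasDerivAt_pow 2 x).fun_neg).div_const 2).exp
    convert this using 2
    simp; ring
  refine HasDerivAt.congr_deriv ((p.hasDerivAt x).mul h1) ?_
  simp [W]
  ring

lemma W_cont (p : Polynomial ℝ) : Continuous (W p) := by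
  unfold W; fun_prop

open Polynomial in
lemma PiH_rep {n : ℕ} {P : ℝ → ℝ} (h : P ∈ PiH n) : ∃ a : ℕ → ℝ, P = W (∑ k ∈ Finset.range n, C (a k) * hP k) := by
  unfold PiH at h
  induction h using Submodule.span_induction with
  | mem f hf =>
    obtain ⟨k, hk, rfl⟩ := hf
    refine ⟨fun j => if j = k then gam k else 0, ?_⟩
    rw [psiH_eq]
    congr 1
    rw [Finset.sum_eq_single k]
    · simp
    · intro b _ hb; simp [hb]
    · simp [hk]
  | zero => exact ⟨0, by ext x; simp [W]⟩
  | add f g _ _ hf hg =>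
    obtain ⟨a, rfl⟩ := hf
    obtain ⟨b, rfl⟩ := hg
    refine ⟨a + b, ?_⟩
    ext x
    simp [W, add_mul, Finset.sum_add_distrib]
  | smul c f _ hf =>
    obtain ⟨a, rfl⟩ := hf
    refine ⟨c • a, ?_⟩
    ext x
    simp [W, eval_finsetSum, Finset.mul_sum, Finset.sum_mul, mul_assoc]

open Polynomial in
lemma I_hP_sum (n : ℕ) (a : ℕ → ℝ) (k : ℕ) (hk : k ∈ Finset.range n) :
    I (hP k * ∑ j ∈ Finset.range n, C (a j) * hP j) = a k * gK k := by
  rw [Finset.mul_sum, map_sum, Finset.sum_eq_single k]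
  · rw [show hP k * (C (a k) * hP k) = a k • (hP k * hP k) by rw [smul_eq_C_mul]; ring, map_smul, I_orth]; simp
  · intro b _ hb
    rw [show hP k * (C (a b) * hP b) = a b • (hP k * hP b) by rw [smul_eq_C_mul]; ring, map_smul, I_orth]; simp [hb.symm]
  · intro h; exact absurd hk h

open Polynomial in
lemma I_sq (n : ℕ) (a : ℕ → ℝ) :
    I ((∑ j ∈ Finset.range n, C (a j) * hP j) * ∑ j ∈ Finset.range n, C (a j) * hP j) = ∑ k ∈ Finset.range n, a k ^ 2 * gK k := by
  rw [Finset.sum_mul, map_sum]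
  refine Finset.sum_congr rfl fun k hk => ?_
  rw [mul_assoc, ← smul_eq_C_mul, map_smul, I_hP_sum n a k hk]; simp; ring

open Polynomial in
lemma I_dsq (n : ℕ) (a : ℕ → ℝ) :
    I (derivative (∑ j ∈ Finset.range n, C (a j) * hP j) * derivative (∑ j ∈ Finset.range n, C (a j) * hP j)) = ∑ k ∈ Finset.range n, 2 * k * (a k ^ 2 * gK k) := by
  set p := ∑ j ∈ Finset.range n, C (a j) * hP j with hp
  conv_lhs => 
    enter [2,1]
    rw [hp, derivative_sum]
  rw [Finset.sum_mul, map_sum]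
  refine Finset.sum_congr rfl fun k hk => ?_
  rw [derivative_C_mul]
  cases k with
  | zero => simp [hP]
  | succ k =>
    rw [hP_deriv, show C (a (k+1)) * (2 * ((k:ℝ[X]) + 1) * hP k) * derivative p = (a (k+1) * (2 * ((k:ℝ)+1))) • (hP k * derivative p) by rw [smul_eq_C_mul]; simp [C2]; ring, map_smul, ← I_shift, I_hP_sum n a _ hk]
    simp; ring

open Polynomial in
lemma PiH_energy {n : ℕ} {P : ℝ → ℝ} (h : P ∈ PiH n) : ∃ p : ℝ[X], P = W p ∧
    I (derivative p * derivative p) + I (p * p) ≤ 2 * n * I (p * p) := by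
  obtain ⟨a, rfl⟩ := PiH_rep h
  refine ⟨_, rfl, ?_⟩
  rw [I_sq, I_dsq, Finset.mul_sum, ← Finset.sum_add_distrib]
  refine Finset.sum_le_sum fun k hk => ?_
  have := gK_pos k
  have : 0 ≤ a k ^ 2 * gK k := by positivity
  have hk : (k:ℝ) + 1 ≤ n := by exact_mod_cast Finset.mem_range.1 hk
  nlinarith

open Polynomial in
lemma I_nonneg (p : ℝ[X]) : 0 ≤ I (p * p) := by
  rw [← I_W]; exact integral_nonneg fun x => mul_self_nonneg _

open Polynomial in
lemma energy_eq (p : ℝ[X]) : I ((derivative p - X * p) * (derivative p - X * p)) + I ((X * p) * (X * p)) =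
    I (derivative p * derivative p) + I (p * p) := by
  have := I_parts (X * (p * p))
  have e : (derivative p - X * p) * (derivative p - X * p) + (X * p) * (X * p) =
    derivative p * derivative p + p * p - (derivative (X * (p * p)) - 2 * X * (X * (p * p))) := by
    simp only [derivative_mul, derivative_X]; ring
  rw [← map_add, e, map_sub, this, map_add, sub_zero]

open Polynomial in
lemma sup_bd (p : ℝ[X]) (x t : ℝ) (ht : 0 < t) : W p x ^ 2 ≤ t * I (p * p) + t⁻¹ * I ((derivative p - X * p) * (derivative p - X * p)) := by
  set d := derivative p - X * p with hd
  have h1 : ∀ y, HasDerivAt (fun y => W p y * W p y) (W d y * W p y + W p y * W d y) y := fun y => (W_deriv p y).mul (W_deriv p y)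
  have hi : Integrable (fun y => W d y * W p y + W p y * W d y) := (W_mul_int d p).add (W_mul_int p d)
  have hz := tendsto_zero_of_hasDerivAt_of_integrableOn_Iic (a := x) (fun y _ => h1 y) hi.integrableOn (W_mul_int p p).integrableOn
  have := integral_Iic_of_hasDerivAt_of_tendsto' (a := x) (fun y _ => h1 y) hi.integrableOn hz
  rw [sub_zero] at this
  rw [pow_two, ← this, ← I_W, ← I_W, ← integral_const_mul, ← integral_const_mul, ← integral_add ((W_mul_int p p).const_mul _) ((W_mul_int d d).const_mul _)]
  have hpt : ∀ y, W d y * W p y + W p y * W d y ≤ t * (W p y * W p y) + t⁻¹ * (W d y * W d y) := by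
    intro y
    have : 0 ≤ t⁻¹ * (t * W p y - W d y)^2 := by positivity
    have e : t⁻¹ * (t * W p y - W d y)^2 = t * (W p y * W p y) + t⁻¹ * (W d y * W d y) - (W d y * W p y + W p y * W d y) := by
      field_simp; ring
    linarith
  calc _ ≤ ∫ y in Set.Iic x, (t * (W p y * W p y) + t⁻¹ * (W d y * W d y)) := by
        refine integral_mono hi.integrableOn ?_ hpt
        exact (((W_mul_int p p).const_mul _).add ((W_mul_int d d).const_mul _)).integrableOn
    _ ≤ _ := by
        refine setIntegral_le_integral (((W_mul_int p p).const_mul _).add ((W_mul_int d d).const_mul _)) (ae_of_all _ fun y => ?_)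
        have := mul_self_nonneg (W p y)
        have := mul_self_nonneg (W d y)
        simp only [Pi.zero_apply]
        positivity

lemma PiH_cont {n : ℕ} {P : ℝ → ℝ} (h : P ∈ PiH n) : Continuous P := by
  obtain ⟨a, rfl⟩ := PiH_rep h
  exact W_cont _

lemma PiH_mono {n m : ℕ} (h : n ≤ m) : PiH n ≤ PiH m := by
  refine Submodule.span_mono ?_
  rintro f ⟨k, hk, rfl⟩
  exact ⟨k, by omega, rfl⟩

lemma lint_W (p : Polynomial ℝ) : ∫⁻ t, ENNReal.ofReal (W p t ^ 2) = ENNReal.ofReal (I (p * p)) := by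
  rw [← I_W, ofReal_integral_eq_lintegral_ofReal (W_mul_int p p) (ae_of_all _ fun x => mul_self_nonneg _)]
  simp_rw [pow_two]

lemma W_smul (c : ℝ) (p : Polynomial ℝ) : W (Polynomial.C c * p) = c • W p := by
  ext x; simp [W]; ring

lemma W_hP_mem {n k : ℕ} (h : k < n) : W (hP k) ∈ PiH n := by
  have h1 : psiH k ∈ PiH n := Submodule.subset_span ⟨k, h, rfl⟩
  rw [psiH_eq, W_smul] at h1
  have hg : gam k ≠ 0 := by
    intro h0
    have := gam_sq k
    rw [h0] at this; norm_num at this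
  have := (PiH n).smul_mem (gam k)⁻¹ h1
  rwa [inv_smul_smul₀ hg] at this

open Polynomial in
lemma hP_X (k : ℕ) : (fun t => t * W (hP k) t) ∈ PiH (k+2) := by
  cases k with
  | zero =>
    have : (fun t => t * W (hP 0) t) = (2⁻¹ : ℝ) • W (hP 1) := by
      ext t; simp [W, hP]; ring
    rw [this]
    exact (PiH _).smul_mem _ (W_hP_mem (by omega))
  | succ k =>
    have : (fun t => t * W (hP (k+1)) t) = (2⁻¹ : ℝ) • W (hP (k+2)) + ((k:ℝ)+1) • W (hP k) := by
      ext t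
      have h1 : hP (k+2) = 2 * X * hP (k+1) - (2 * ((k:ℝ[X]) + 1)) * hP k := by
        rw [← hP_deriv, hP]
      rw [h1]
      simp [W]; ring
    rw [this]
    exact (PiH _).add_mem ((PiH _).smul_mem _ (W_hP_mem (by omega))) ((PiH _).smul_mem _ (W_hP_mem (by omega)))

lemma PiH_X {n : ℕ} {P : ℝ → ℝ} (h : P ∈ PiH n) : (fun t => t * P t) ∈ PiH (n+1) := by
  obtain ⟨a, rfl⟩ := PiH_rep h
  have : (fun t => t * W (∑ k ∈ Finset.range n, Polynomial.C (a k) * hP k) t) =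
      ∑ k ∈ Finset.range n, a k • (fun t => t * W (hP k) t) := by
    ext t
    simp [W, Polynomial.eval_finsetSum, Finset.mul_sum, Finset.sum_mul]
    refine Finset.sum_congr rfl fun k _ => by ring
  rw [this]
  refine Submodule.sum_mem _ fun k hk => (PiH _).smul_mem _ ?_
  exact PiH_mono (by have := Finset.mem_range.1 hk; omega) (hP_X k)

lemma key {n : ℕ} (hn : 1 ≤ n) {P : ℝ → ℝ} (h : P ∈ PiH n) {E : ℝ} (hE0 : 0 ≤ E)
    (hE : ∫⁻ t, ENNReal.ofReal (P t ^ 2) ≤ ENNReal.ofReal E) :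
    (∫⁻ t, ENNReal.ofReal ((t * P t) ^ 2) ≤ ENNReal.ofReal (2 * n * E)) ∧
    (∀ x, P x ^ 2 ≤ 3 * √n * E) := by
  obtain ⟨p, rfl, hp⟩ := PiH_energy h
  rw [lint_W, ENNReal.ofReal_le_ofReal_iff hE0] at hE
  have he := energy_eq p
  have h1 := I_nonneg (Polynomial.X * p)
  have h2 := I_nonneg (Polynomial.derivative p - Polynomial.X * p)
  have hn0 : (0:ℝ) < n := by exact_mod_cast hn
  have h3 : 2 * n * I (p * p) ≤ 2 * n * E := by gcongr
  constructor
  · have : ∀ t, t * W p t = W (Polynomial.X * p) t := by intro t; simp [W]; ring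
    simp_rw [this]
    rw [lint_W]
    exact ENNReal.ofReal_le_ofReal (by linarith)
  · intro x
    have hs : 0 < √(n:ℝ) := Real.sqrt_pos.2 hn0
    refine (sup_bd p x _ hs).trans ?_
    have : (√(n:ℝ))⁻¹ * I ((Polynomial.derivative p - Polynomial.X * p) * (Polynomial.derivative p - Polynomial.X * p)) ≤ (√(n:ℝ))⁻¹ * (2 * n * E) := by
      gcongr; linarith
    have e : (√(n:ℝ))⁻¹ * (2 * n * E) = 2 * √n * E := by
      field_simp; rw [Real.sq_sqrt hn0.le]
    have : √(n:ℝ) * I (p * p) ≤ √n * E := by gcongr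
    linarith

lemma weight (μ : Measure ℝ) {D : ℝ} (hD0 : 0 ≤ D)
    (hD : ∀ R : ℝ, 1 ≤ R → μ (Set.Icc (-R) R) ≤ ENNReal.ofReal (D * R)) {n : ℕ} (hn : 1 ≤ n) :
    ∫⁻ y, ENNReal.ofReal (1 / (1 + y ^ 2 / n)) ∂μ ≤ ENNReal.ofReal (8 * D * √n) := by
  have hn1 : (1:ℝ) ≤ n := by exact_mod_cast hn
  have hs1 : 1 ≤ √(n:ℝ) := Real.one_le_sqrt.2 hn1
  have hs : 0 < √(n:ℝ) := by linarith
  set S : ℕ → Set ℝ := fun j => Set.Icc (-(2 ^ j * √(n:ℝ))) (2 ^ j * √n) with hS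
  have hpt : ∀ y : ℝ, ENNReal.ofReal (1 / (1 + y ^ 2 / n)) ≤
      ∑' j : ℕ, ENNReal.ofReal (4 * (1/4) ^ j) * (S j).indicator 1 y := by
    intro y
    have hex : ∃ j : ℕ, |y| ≤ 2 ^ j * √(n:ℝ) := by
      obtain ⟨j, hj⟩ := pow_unbounded_of_one_lt |y| (one_lt_two : (1:ℝ) < 2)
      exact ⟨j, hj.le.trans (le_mul_of_one_le_right (by positivity) hs1)⟩
    classical
    set j := Nat.find hex with hj
    have hjs : |y| ≤ 2 ^ j * √(n:ℝ) := Nat.find_spec hex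
    refine le_trans ?_ (ENNReal.le_tsum j)
    have hy : y ∈ S j := abs_le.1 hjs
    rw [Set.indicator_of_mem hy]
    simp only [Pi.one_apply, mul_one]
    refine ENNReal.ofReal_le_ofReal ?_
    rcases Nat.eq_zero_or_pos j with h0 | h0
    · rw [h0]
      rw [div_le_iff₀ (by positivity)]
      have : 0 ≤ y ^ 2 / n := by positivity
      norm_num; linarith
    · obtain ⟨i, hi⟩ : ∃ i, j = i + 1 := ⟨j - 1, by omega⟩
      have hlt : 2 ^ i * √(n:ℝ) < |y| := by
        have := Nat.find_min hex (m := i) (by omega)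
        exact not_le.1 this
      rw [hi]
      have h4 : (4:ℝ) ^ i ≤ y ^ 2 / n := by
        rw [le_div_iff₀ (by linarith)]
        calc (4:ℝ) ^ i * n = (2 ^ i * √(n:ℝ)) ^ 2 := by
              rw [mul_pow, Real.sq_sqrt (by linarith), ← pow_mul, mul_comm i 2, pow_mul]; norm_num
          _ ≤ |y| ^ 2 := by gcongr
          _ = y ^ 2 := sq_abs y
      rw [pow_succ (1/4 : ℝ) i, div_le_iff₀ (by positivity)]
      have : (1:ℝ) = (1/4)^i * 4 ^ i := by rw [← mul_pow]; norm_num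
      have h5 : (0:ℝ) < (1/4)^i := by positivity
      nlinarith
  refine (lintegral_mono hpt).trans ?_
  rw [lintegral_tsum (fun j => ((measurable_one.indicator measurableSet_Icc).const_mul _).aemeasurable)]
  have hterm : ∀ j : ℕ, ∫⁻ y, ENNReal.ofReal (4 * (1/4) ^ j) * (S j).indicator 1 y ∂μ ≤
      ENNReal.ofReal (4 * D * √n * (1/2) ^ j) := by
    intro j
    rw [lintegral_const_mul _ (measurable_one.indicator measurableSet_Icc), lintegral_indicator_one measurableSet_Icc]
    have h1 : 1 ≤ 2 ^ j * √(n:ℝ) := by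
      have : (1:ℝ) ≤ 2 ^ j := one_le_pow₀ (by norm_num)
      nlinarith
    refine (mul_le_mul_right (hD _ h1) _).trans ?_
    rw [← ENNReal.ofReal_mul (by positivity)]
    refine ENNReal.ofReal_le_ofReal (le_of_eq ?_)
    have : (1/2:ℝ)^j = (1/4)^j * 2 ^ j := by rw [← mul_pow]; norm_num
    rw [this]; ring
  refine (ENNReal.tsum_le_tsum hterm).trans ?_
  rw [← ENNReal.ofReal_tsum_of_nonneg (fun j => by positivity) (summable_geometric_two.mul_left _), tsum_mul_left, tsum_geometric_two]
  exact ENNReal.ofReal_le_ofReal (by linarith)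

lemma L1_bd (μ : Measure ℝ) {D : ℝ} (hD0 : 0 ≤ D)
    (hD : ∀ R : ℝ, 1 ≤ R → μ (Set.Icc (-R) R) ≤ ENNReal.ofReal (D * R)) {n : ℕ} (hn : 1 ≤ n)
    {P : ℝ → ℝ} (hP : Continuous P) {E : ℝ} (hE0 : 0 ≤ E)
    (h1 : ∫⁻ t, ENNReal.ofReal (P t ^ 2) ∂μ ≤ ENNReal.ofReal E)
    (h2 : ∫⁻ t, ENNReal.ofReal ((t * P t) ^ 2) ∂μ ≤ ENNReal.ofReal (2 * n * E)) {s : ℝ} (hs : 0 < s) :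
    ∫⁻ t, ENNReal.ofReal |P t| ∂μ ≤ ENNReal.ofReal (3 * s * E + 8 * D * √n / s) := by
  have hn0 : (0:ℝ) < n := by exact_mod_cast hn
  have hpt : ∀ t, ENNReal.ofReal |P t| ≤ ENNReal.ofReal s * ENNReal.ofReal (P t ^ 2) +
      ENNReal.ofReal (s / n) * ENNReal.ofReal ((t * P t) ^ 2) + ENNReal.ofReal (1/s) * ENNReal.ofReal (1 / (1 + t ^ 2 / n)) := by
    intro t
    rw [← ENNReal.ofReal_mul hs.le, ← ENNReal.ofReal_mul (by positivity), ← ENNReal.ofReal_mul (by positivity), ← ENNReal.ofReal_add (by positivity) (by positivity), ← ENNReal.ofReal_add (by positivity) (by positivity)]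
    refine ENNReal.ofReal_le_ofReal ?_
    set v := 1 + t ^ 2 / n with hv
    have hv0 : 0 < v := by positivity
    have e : s * P t ^ 2 + s / n * (t * P t) ^ 2 = s * v * |P t| ^ 2 := by
      rw [hv, sq_abs]; field_simp
    rw [e]
    have : 0 ≤ (s * v * |P t| - 1) ^ 2 / (s * v) := by positivity
    have e2 : (s * v * |P t| - 1) ^ 2 / (s * v) = s * v * |P t| ^ 2 + 1/s * (1/v) - 2 * |P t| := by
      field_simp; ring
    have := abs_nonneg (P t)
    linarith
  refine (lintegral_mono hpt).trans ?_
  have m1 : Measurable fun t => ENNReal.ofReal (P t ^ 2) := (hP.pow 2).measurable.ennreal_ofReal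
  have m2 : Measurable fun t => ENNReal.ofReal ((t * P t) ^ 2) := ((continuous_id.mul hP).pow 2).measurable.ennreal_ofReal
  have m3 : Measurable fun t : ℝ => ENNReal.ofReal (1 / (1 + t ^ 2 / n)) := by fun_prop
  rw [lintegral_add_left ((m1.const_mul _).fun_add (m2.const_mul _)), lintegral_add_left (m1.const_mul _), lintegral_const_mul _ m1, lintegral_const_mul _ m2, lintegral_const_mul _ m3]
  have hw := weight μ hD0 hD hn
  calc _ ≤ ENNReal.ofReal s * ENNReal.ofReal E + ENNReal.ofReal (s / n) * ENNReal.ofReal (2 * n * E) + ENNReal.ofReal (1/s) * ENNReal.ofReal (8 * D * √n) := by gcongr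
    _ = _ := by
      rw [← ENNReal.ofReal_mul hs.le, ← ENNReal.ofReal_mul (by positivity), ← ENNReal.ofReal_mul (by positivity), ← ENNReal.ofReal_add (by positivity) (by positivity), ← ENNReal.ofReal_add (by positivity) (by positivity)]
      congr 1
      field_simp; ring

lemma L1_vol {n : ℕ} (hn : 1 ≤ n) {P : ℝ → ℝ} (h : P ∈ PiH n) {E : ℝ} (hE0 : 0 ≤ E)
    (hE : ∫⁻ t, ENNReal.ofReal (P t ^ 2) ≤ ENNReal.ofReal E) {s : ℝ} (hs : 0 < s) :
    ∫⁻ t, ENNReal.ofReal |P t| ≤ ENNReal.ofReal (3 * s * E + 16 * √n / s) := by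
  have := L1_bd volume (D := 2) (by norm_num) (fun R hR => by
    rw [Real.volume_Icc]; exact ENNReal.ofReal_le_ofReal (by linarith)) hn (PiH_cont h) hE0 hE (key hn h hE0 hE).1 hs
  norm_num at this
  exact this

lemma psi_mem {n k : ℕ} (h : k < n) : psiH k ∈ PiH n := Submodule.subset_span ⟨k, h, rfl⟩

lemma lint_psi (k : ℕ) : ∫⁻ t, ENNReal.ofReal (psiH k t ^ 2) = 1 := by
  rw [psiH_eq, lint_W, show Polynomial.C (gam k) * hP k * (Polynomial.C (gam k) * hP k) = (gam k ^ 2) • (hP k * hP k) by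
    rw [Polynomial.smul_eq_C_mul, Polynomial.C_pow]; ring, map_smul, I_orth]
  simp [gam_sq]

lemma nu_ball {c₁ c₂ c₃ c₄ C c₀ : ℝ} (h₂ : 0 < c₂) (h₄ : 0 < c₄)
    (hC : 0 < C) (hc₀ : 0 < c₀)
    (hChrist : ∀ m : ℕ, 1 ≤ m → ∀ x : ℝ, |x| ≤ C * Real.sqrt m →
      c₀ * Real.sqrt m ≤ ∑ j ∈ Finset.range m, psiH j x ^ 2) {m : ℕ} {ν : Measure ℝ}
    (hν : SMZ m c₁ c₂ c₃ c₄ ν) (R : ℝ) (hR : 1 ≤ R) :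
    ν (Set.Icc (-R) R) ≤ ENNReal.ofReal ((c₂ / c₀ * (1 / C + 1) + c₄ / C) * R) := by
  obtain ⟨hν, -, hν4⟩ := hν
  by_cases hRC : C * √m < R
  · refine (measure_mono (Set.subset_univ _)).trans (hν4.trans (ENNReal.ofReal_le_ofReal ?_))
    have : √(m:ℝ) ≤ R / C := by rw [le_div_iff₀ hC]; linarith
    have : c₄ * √m ≤ c₄ * (R / C) := by gcongr
    have : 0 ≤ c₂ / c₀ * (1 / C + 1) * R := by positivity
    have e : c₄ * (R / C) = c₄ / C * R := by ring
    linarith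
  · push Not at hRC
    set k := ⌈R ^ 2 / C ^ 2⌉₊ with hk
    have hk1 : 1 ≤ k := Nat.one_le_iff_ne_zero.2 (Nat.ceil_pos.2 (by positivity)).ne'
    have hkm : k ≤ m := by
      refine Nat.ceil_le.2 ?_
      rw [div_le_iff₀ (by positivity)]
      calc R ^ 2 ≤ (C * √m) ^ 2 := by gcongr
        _ = _ := by rw [mul_pow, Real.sq_sqrt (by positivity)]; ring
    have hkr : R ^ 2 / C ^ 2 ≤ k := Nat.le_ceil _
    have hkr2 : (k:ℝ) < R ^ 2 / C ^ 2 + 1 := Nat.ceil_lt_add_one (by positivity)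
    have hkp : (0:ℝ) < k := by exact_mod_cast hk1
    have hsk : R ≤ C * √k := by
      have : R / C ≤ √k := Real.le_sqrt_of_sq_le (by rwa [div_pow])
      rwa [div_le_iff₀' hC] at this
    have hsk2 : √(k:ℝ) ≤ (1 / C + 1) * R := by
      refine Real.sqrt_le_iff.2 ⟨by positivity, ?_⟩
      have : 0 < 1 / C := by positivity
      have e : ((1 / C + 1) * R) ^ 2 = R ^ 2 / C ^ 2 + R ^ 2 + 2 * (1 / C) * R ^ 2 := by field_simp; ring
      rw [e]
      have : 0 ≤ 2 * (1 / C) * R ^ 2 := by positivity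
      nlinarith
    have hmul : ENNReal.ofReal (c₀ * √k) * ν (Set.Icc (-R) R) ≤ ENNReal.ofReal (c₂ * k) := by
      calc ENNReal.ofReal (c₀ * √k) * ν (Set.Icc (-R) R) = ∫⁻ _ in Set.Icc (-R) R, ENNReal.ofReal (c₀ * √k) ∂ν := by simp
        _ ≤ ∫⁻ t in Set.Icc (-R) R, ∑ j ∈ Finset.range k, ENNReal.ofReal (psiH j t ^ 2) ∂ν := by
            refine setLIntegral_mono' measurableSet_Icc fun t ht => ?_
            rw [← ENNReal.ofReal_sum_of_nonneg (fun _ _ => sq_nonneg _)]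
            exact ENNReal.ofReal_le_ofReal (hChrist k hk1 t ((abs_le.2 ht).trans hsk))
        _ ≤ ∫⁻ t, ∑ j ∈ Finset.range k, ENNReal.ofReal (psiH j t ^ 2) ∂ν := setLIntegral_le_lintegral _ _
        _ = ∑ j ∈ Finset.range k, ∫⁻ t, ENNReal.ofReal (psiH j t ^ 2) ∂ν := by
            refine lintegral_finsetSum _ fun j hj => ?_
            exact ((PiH_cont (psi_mem (Nat.lt_succ_self j))).pow 2).measurable.ennreal_ofReal
        _ ≤ ∑ j ∈ Finset.range k, ENNReal.ofReal c₂ := by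
            refine Finset.sum_le_sum fun j hj => ?_
            refine (hν _ (psi_mem (lt_of_lt_of_le (Finset.mem_range.1 hj) hkm))).2.trans ?_
            rw [lint_psi, mul_one]
        _ = _ := by
            rw [Finset.sum_const, Finset.card_range, mul_comm c₂, ENNReal.ofReal_mul hkp.le]; simp
    have hpos : 0 < c₀ * √k := by positivity
    have : ν (Set.Icc (-R) R) ≤ ENNReal.ofReal (c₂ * k) / ENNReal.ofReal (c₀ * √k) := by
      rw [ENNReal.le_div_iff_mul_le (Or.inl (by simpa using hpos)) (Or.inl ENNReal.ofReal_ne_top), mul_comm]; exact hmul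
    refine this.trans ?_
    rw [← ENNReal.ofReal_div_of_pos hpos]
    refine ENNReal.ofReal_le_ofReal ?_
    have e : c₂ * k / (c₀ * √k) = c₂ / c₀ * √k := by
      have : (k:ℝ) = √k * √k := (Real.mul_self_sqrt hkp.le).symm
      have hk0 : √(k:ℝ) ≠ 0 := by positivity
      rw [div_eq_iff hpos.ne']
      nth_rw 1 [this]
      field_simp
    rw [e]
    have : c₂ / c₀ * √k ≤ c₂ / c₀ * ((1 / C + 1) * R) := by gcongr
    have : 0 ≤ c₄ / C * R := by positivity
    linarith

lemma L1_univ (μ : Measure ℝ) {A E s : ℝ} (hA : 0 ≤ A) (hE0 : 0 ≤ E) (hμ : μ Set.univ ≤ ENNReal.ofReal A)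
    {P : ℝ → ℝ} (hP : Continuous P)
    (h1 : ∫⁻ t, ENNReal.ofReal (P t ^ 2) ∂μ ≤ ENNReal.ofReal E) (hs : 0 < s) :
    ∫⁻ t, ENNReal.ofReal |P t| ∂μ ≤ ENNReal.ofReal (s * E + A / s) := by
  have hpt : ∀ t, ENNReal.ofReal |P t| ≤ ENNReal.ofReal s * ENNReal.ofReal (P t ^ 2) + ENNReal.ofReal (1/s) := by
    intro t
    rw [← ENNReal.ofReal_mul hs.le, ← ENNReal.ofReal_add (by positivity) (by positivity)]
    refine ENNReal.ofReal_le_ofReal ?_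
    have : 0 ≤ (s * |P t| - 1) ^ 2 / s := by positivity
    have e2 : (s * |P t| - 1) ^ 2 / s = s * |P t| ^ 2 + 1/s - 2 * |P t| := by
      field_simp; ring
    rw [sq_abs] at e2
    have := abs_nonneg (P t)
    linarith
  refine (lintegral_mono hpt).trans ?_
  have m1 : Measurable fun t => ENNReal.ofReal (P t ^ 2) := (hP.pow 2).measurable.ennreal_ofReal
  rw [lintegral_add_left (m1.const_mul _), lintegral_const_mul _ m1, lintegral_const]
  calc _ ≤ ENNReal.ofReal s * ENNReal.ofReal E + ENNReal.ofReal (1/s) * ENNReal.ofReal A := by gcongr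
    _ = _ := by
      rw [← ENNReal.ofReal_mul hs.le, ← ENNReal.ofReal_mul (by positivity), ← ENNReal.ofReal_add (by positivity) (by positivity)]
      congr 1
      field_simp

lemma L1_nu {c₁ c₂ c₃ c₄ C c₀ : ℝ} (h₂ : 0 < c₂) (h₄ : 0 < c₄)
    (hC : 0 < C) (hc₀ : 0 < c₀)
    (hChrist : ∀ m : ℕ, 1 ≤ m → ∀ x : ℝ, |x| ≤ C * Real.sqrt m →
      c₀ * Real.sqrt m ≤ ∑ j ∈ Finset.range m, psiH j x ^ 2) {m n : ℕ} (hn : 1 ≤ n) (hnm : n ≤ m) {ν : Measure ℝ}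
    (hν : SMZ m c₁ c₂ c₃ c₄ ν) {P : ℝ → ℝ} (h : P ∈ PiH n) {E : ℝ} (hE0 : 0 ≤ E)
    (hE : ∫⁻ t, ENNReal.ofReal (P t ^ 2) ≤ ENNReal.ofReal E) :
    ∫⁻ t, ENNReal.ofReal |P t| ∂ν ≤ ENNReal.ofReal (3 * c₂ * E + (8 * (c₂ / c₀ * (1 / C + 1) + c₄ / C) + c₄) * √n) := by
  have hball := nu_ball h₂ h₄ hC hc₀ hChrist hν
  obtain ⟨hν, -, hν4⟩ := hν
  have h1 : ∫⁻ t, ENNReal.ofReal (P t ^ 2) ∂ν ≤ ENNReal.ofReal (c₂ * E) := by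
    refine (hν P (PiH_mono hnm h)).2.trans ?_
    rw [ENNReal.ofReal_mul h₂.le]; gcongr
  rcases hnm.eq_or_lt with rfl | hlt
  · refine (L1_univ ν (by positivity) (by positivity) hν4 (PiH_cont h) h1 one_pos).trans (ENNReal.ofReal_le_ofReal ?_)
    have : 0 ≤ 8 * (c₂ / c₀ * (1 / C + 1) + c₄ / C) * √n := by positivity
    have : 0 ≤ c₂ * E := by positivity
    linarith
  · have h2 : ∫⁻ t, ENNReal.ofReal ((t * P t) ^ 2) ∂ν ≤ ENNReal.ofReal (2 * n * (c₂ * E)) := by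
      refine (hν _ (PiH_mono hlt (PiH_X h))).2.trans ?_
      rw [show 2 * n * (c₂ * E) = c₂ * (2 * n * E) by ring, ENNReal.ofReal_mul h₂.le]
      gcongr
      exact (key hn h hE0 hE).1
    refine (L1_bd ν (by positivity) hball hn (PiH_cont h) (by positivity) h1 h2 one_pos).trans (ENNReal.ofReal_le_ofReal ?_)
    have : 0 ≤ c₄ * √n := by positivity
    linarith

lemma PiH_integrable {n : ℕ} (hn : 1 ≤ n) {P : ℝ → ℝ} (h : P ∈ PiH n) : Integrable P := by
  refine ⟨(PiH_cont h).aestronglyMeasurable, ?_⟩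
  obtain ⟨p, rfl, -⟩ := PiH_energy h
  have := L1_vol hn h (I_nonneg p) (lint_W p).le one_pos
  rw [hasFiniteIntegral_iff_norm]
  exact lt_of_le_of_lt this ENNReal.ofReal_lt_top

lemma exp_norm (ω t : ℝ) : ‖Complex.exp (-(Complex.I * ω * t))‖ = 1 := by
  rw [Complex.norm_exp]; simp

lemma fourier_integrable {f : ℝ → ℝ} (hf : Integrable f) (ω : ℝ) :
    Integrable (fun t : ℝ => (f t : ℂ) * Complex.exp (-(Complex.I * ω * t))) := by
  refine (hf.norm).mono' ?_ (ae_of_all _ fun t => ?_)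
  · exact hf.ofReal.aestronglyMeasurable.mul (by fun_prop : Continuous _).aestronglyMeasurable
  · rw [norm_mul, exp_norm]; simp

lemma fourier_bd {f : ℝ → ℝ} (hf : Integrable f) (ω : ℝ) {B : ℝ} (hB : 0 ≤ B)
    (h : ∫⁻ t, ENNReal.ofReal |f t| ≤ ENNReal.ofReal B) : ‖fourierT f ω‖ ≤ B := by
  unfold fourierT
  rw [norm_mul]
  have h1 : ‖(√(2 * Real.pi) : ℂ)⁻¹‖ ≤ 1 := by
    rw [norm_inv, Complex.norm_real, Real.norm_of_nonneg (Real.sqrt_nonneg _)]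
    refine inv_le_one_of_one_le₀ (Real.one_le_sqrt.2 ?_)
    linarith [Real.pi_gt_three]
  have h2 : ‖∫ t : ℝ, (f t : ℂ) * Complex.exp (-(Complex.I * ω * t))‖ ≤ B := by
    refine (norm_integral_le_integral_norm _).trans ?_
    simp_rw [norm_mul, exp_norm, mul_one, Complex.norm_real, Real.norm_eq_abs]
    rw [← ENNReal.ofReal_le_ofReal_iff hB, ofReal_integral_eq_lintegral_ofReal hf.abs (ae_of_all _ fun x => abs_nonneg _)]
    exact h
  calc _ ≤ 1 * B := by gcongr
    _ = B := one_mul B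

lemma fourier_sum {n : ℕ} (q : Fin n → ℝ → ℝ) (hq : ∀ j, Integrable (q j)) (a : Fin n → ℝ) (ω : ℝ) :
    fourierT (fun y => ∑ j, a j * q j y) ω = ∑ j, (a j : ℂ) * fourierT (q j) ω := by
  unfold fourierT
  have : ∀ t : ℝ, ((∑ j, a j * q j t : ℝ) : ℂ) * Complex.exp (-(Complex.I * ω * t)) =
      ∑ j, (a j : ℂ) * ((q j t : ℂ) * Complex.exp (-(Complex.I * ω * t))) := by
    intro t; push_cast; rw [Finset.sum_mul]; exact Finset.sum_congr rfl fun j _ => by ring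
  simp_rw [this]
  rw [integral_finsetSum _ (fun j _ => (fourier_integrable (hq j) ω).const_mul _), Finset.mul_sum]
  refine Finset.sum_congr rfl fun j _ => ?_
  rw [integral_const_mul]; ring

lemma comb_mem {n : ℕ} {q : Fin n → ℝ → ℝ} (hq : ∀ j : Fin n, q j ∈ PiH (j + 1)) (a : Fin n → ℝ) :
    (fun y => ∑ j, a j * q j y) ∈ PiH n := by
  have : (fun y => ∑ j, a j * q j y) = ∑ j, a j • q j := by ext y; simp
  rw [this]
  exact Submodule.sum_mem _ fun j _ => (PiH n).smul_mem _ (PiH_mono (by omega) (hq j))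

lemma comb_bd {c₁ c₂ c₃ c₄ : ℝ} (h₁ : 0 < c₁) {m n : ℕ} (hnm : n ≤ m) {ν : Measure ℝ}
    (hν : SMZ m c₁ c₂ c₃ c₄ ν) {q : Fin n → ℝ → ℝ} (hq : ∀ j : Fin n, q j ∈ PiH (j + 1))
    (ho : ∀ i j : Fin n, (∫ x, q i x * q j x ∂ν) = if i = j then 1 else 0) (a : Fin n → ℝ) :
    ∫⁻ y, ENNReal.ofReal ((∑ j, a j * q j y) ^ 2) ≤ ENNReal.ofReal ((∑ j, a j ^ 2) / c₁) := by
  obtain ⟨hν, -⟩ := hν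
  have hmem : ∀ j, MemLp (q j) 2 ν := by
    intro j
    rw [memLp_two_iff_integrable_sq (PiH_cont (hq j)).aestronglyMeasurable]
    refine ⟨((PiH_cont (hq j)).pow 2).aestronglyMeasurable, ?_⟩
    rw [hasFiniteIntegral_iff_ofReal (ae_of_all _ fun x => sq_nonneg _)]
    refine lt_of_le_of_lt (hν (q j) (PiH_mono (by omega) (hq j))).2 ?_
    obtain ⟨p, hp, -⟩ := PiH_energy (hq j)
    rw [hp, lint_W]
    exact ENNReal.mul_lt_top ENNReal.ofReal_lt_top ENNReal.ofReal_lt_top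
  have hint : ∀ i j, Integrable (fun x => q i x * q j x) ν := fun i j => (hmem i).integrable_mul (hmem j)
  have hexp : ∀ y, (∑ j, a j * q j y) ^ 2 = ∑ i, ∑ j, (a i * a j) * (q i y * q j y) := by
    intro y
    rw [pow_two, Finset.sum_mul_sum]
    exact Finset.sum_congr rfl fun i _ => Finset.sum_congr rfl fun j _ => by ring
  have hI : Integrable (fun y => (∑ j, a j * q j y) ^ 2) ν := by
    simp_rw [hexp]
    exact integrable_finsetSum _ fun i _ => integrable_finsetSum _ fun j _ => (hint i j).const_mul _
  have hval : ∫ y, (∑ j, a j * q j y) ^ 2 ∂ν = ∑ j, a j ^ 2 := by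
    simp_rw [hexp]
    rw [integral_finsetSum _ fun i _ => integrable_finsetSum _ fun j _ => (hint i j).const_mul _]
    refine Finset.sum_congr rfl fun i _ => ?_
    rw [integral_finsetSum _ fun j _ => (hint i j).const_mul _]
    simp_rw [integral_const_mul, ho]
    simp [pow_two]
  have h := (hν _ (PiH_mono hnm (comb_mem hq a))).1
  rw [← ofReal_integral_eq_lintegral_ofReal hI (ae_of_all _ fun x => sq_nonneg _), hval] at h
  rw [ENNReal.ofReal_div_of_pos h₁, ENNReal.le_div_iff_mul_le (Or.inl (by simpa using h₁)) (Or.inl ENNReal.ofReal_ne_top), mul_comm]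
  exact h

lemma sq_aux {S A : ℝ} (hS : 0 ≤ S) (hA : 0 ≤ A) (h : S ^ 2 ≤ A * S) : S ≤ A := by
  rcases hS.eq_or_lt with h0 | h0
  · linarith
  · exact le_of_mul_le_mul_right (by linarith [pow_two S]) h0

lemma cplx_bd {n : ℕ} (μ : Measure ℝ) (z : Fin n → ℂ) (q : Fin n → ℝ → ℝ) (hq : ∀ j, Continuous (q j)) {B : ℝ} (hB : 0 ≤ B)
    (h1 : ∫⁻ y, ENNReal.ofReal |∑ j, (z j).re * q j y| ∂μ ≤ ENNReal.ofReal B)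
    (h2 : ∫⁻ y, ENNReal.ofReal |∑ j, (z j).im * q j y| ∂μ ≤ ENNReal.ofReal B) :
    ∫⁻ y, ENNReal.ofReal ‖∑ j, z j * (q j y : ℂ)‖ ∂μ ≤ ENNReal.ofReal (2 * B) := by
  have hpt : ∀ y, ENNReal.ofReal ‖∑ j, z j * (q j y : ℂ)‖ ≤ ENNReal.ofReal |∑ j, (z j).re * q j y| + ENNReal.ofReal |∑ j, (z j).im * q j y| := by
    intro y
    rw [← ENNReal.ofReal_add (abs_nonneg _) (abs_nonneg _)]
    refine ENNReal.ofReal_le_ofReal ?_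
    refine (Complex.norm_le_abs_re_add_abs_im _).trans (le_of_eq ?_)
    simp
  refine (lintegral_mono hpt).trans ?_
  rw [lintegral_add_left (by fun_prop), two_mul, ENNReal.ofReal_add hB hB]
  exact add_le_add h1 h2

theorem stmt14 (c₁ c₂ c₃ c₄ C c₀ : ℝ) (h₁ : 0 < c₁) (h₂ : 0 < c₂) (h₃ : 0 < c₃) (h₄ : 0 < c₄)
    (hC : 0 < C) (hc₀ : 0 < c₀)
    (hChrist : ∀ m : ℕ, 1 ≤ m → ∀ x : ℝ, |x| ≤ C * Real.sqrt m →
      c₀ * Real.sqrt m ≤ ∑ j ∈ Finset.range m, psiH j x ^ 2) :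
    ∃ c : ℝ, 0 < c ∧
      ∀ (m n : ℕ), 1 ≤ n → n ≤ m → 4 * (n : ℝ) ≤ C ^ 2 * m →
      ∀ (ν : Measure ℝ), SMZ m c₁ c₂ c₃ c₄ ν →
      ∀ (q : Fin n → ℝ → ℝ), (∀ j : Fin n, q j ∈ PiH (j + 1)) →
        (∀ i j : Fin n, (∫ x, q i x * q j x ∂ν) = if i = j then 1 else 0) →
      ∀ x : ℝ,
        (∫⁻ y, ENNReal.ofReal |∑ j : Fin n, q j x * q j y| ∂ν) ≤
            ENNReal.ofReal (c * Real.sqrt n) ∧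
        (∫⁻ y, ENNReal.ofReal |∑ k ∈ Finset.range n, psiH k x * psiH k y| ∂ν) ≤
            ENNReal.ofReal (c * Real.sqrt n) ∧
        (∫⁻ y, ENNReal.ofReal ‖∑ j : Fin n, fourierT (q j) x * (q j y : ℂ)‖ ∂ν) ≤
            ENNReal.ofReal (c * Real.sqrt n) ∧
        (∫⁻ y : ℝ, ENNReal.ofReal ‖∑ j : Fin n, fourierT (q j) x * (q j y : ℂ)‖) ≤
            ENNReal.ofReal (c * Real.sqrt n) := by
  set B := 8 * (c₂ / c₀ * (1 / C + 1) + c₄ / C) + c₄ with hB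
  have hB0 : 0 < B := by positivity
  set K := 192 / c₁ ^ 2 + 3 with hK
  have hK0 : 0 < K := by positivity
  have hK1 : 192 / c₁ ^ 2 ≤ K := by linarith
  have hK2 : 3 ≤ K := by have : 0 < 192 / c₁ ^ 2 := by positivity
                         linarith
  refine ⟨2 * (3 * c₂ * K + B) + 2 * (3 * K + 16), by positivity, ?_⟩
  intro m n hn hnm _ ν hν q hq ho x
  have hs : 0 < √(n:ℝ) := Real.sqrt_pos.2 (by exact_mod_cast hn)
  have hnu : ∀ P ∈ PiH n, ∫⁻ t, ENNReal.ofReal (P t ^ 2) ≤ ENNReal.ofReal (K * √n) →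
      ∫⁻ t, ENNReal.ofReal |P t| ∂ν ≤ ENNReal.ofReal ((3 * c₂ * K + B) * √n) := by
    intro P hP hE
    refine (L1_nu h₂ h₄ hC hc₀ hChrist hn hnm hν hP (by positivity) hE).trans (ENNReal.ofReal_le_ofReal (le_of_eq ?_))
    ring
  have hvol : ∀ P ∈ PiH n, ∫⁻ t, ENNReal.ofReal (P t ^ 2) ≤ ENNReal.ofReal (K * √n) →
      ∫⁻ t, ENNReal.ofReal |P t| ≤ ENNReal.ofReal ((3 * K + 16) * √n) := by
    intro P hP hE
    refine (L1_vol hn hP (by positivity) hE one_pos).trans (ENNReal.ofReal_le_ofReal (le_of_eq ?_))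
    ring
  have hp1 : 0 ≤ (3 * c₂ * K + B) * √n := by positivity
  have hp2 : 0 ≤ (3 * K + 16) * √n := by positivity
  -- functional bound for Fourier coefficients
  have hfour : ∀ a : Fin n → ℝ, (∑ j, a j ^ 2 ≤ ‖fourierT (fun y => ∑ j, a j * q j y) x‖) →
      ∫⁻ y, ENNReal.ofReal ((∑ j, a j * q j y) ^ 2) ≤ ENNReal.ofReal (K * √n) := by
    intro a ha
    have hS0 : 0 ≤ ∑ j, a j ^ 2 := Finset.sum_nonneg fun _ _ => sq_nonneg _
    have hb := comb_bd h₁ hnm hν hq ho a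
    have hm := comb_mem hq a
    have hl := L1_vol hn hm (by positivity) hb (s := c₁ / 6) (by positivity)
    have hf := ha.trans (fourier_bd (PiH_integrable hn hm) x (by positivity) hl)
    refine hb.trans (ENNReal.ofReal_le_ofReal ?_)
    have e : 3 * (c₁ / 6) * ((∑ j, a j ^ 2) / c₁) + 16 * √n / (c₁ / 6) = (∑ j, a j ^ 2) / 2 + 96 * √n / c₁ := by
      field_simp; ring
    rw [e] at hf
    have e2 : 192 / c₁ ^ 2 * √n = (2 * (96 * √n / c₁)) / c₁ := by field_simp; ring
    calc (∑ j, a j ^ 2) / c₁ ≤ (2 * (96 * √n / c₁)) / c₁ := by gcongr; linarith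
      _ = 192 / c₁ ^ 2 * √n := e2.symm
      _ ≤ K * √n := by gcongr
  have hqi : ∀ j, Integrable (q j) := fun j => PiH_integrable (by omega) (hq j)
  have hqc : ∀ j, Continuous (q j) := fun j => PiH_cont (hq j)
  have hre := hfour (fun j => (fourierT (q j) x).re) (by
    rw [fourier_sum q hqi]
    refine le_trans (le_of_eq ?_) (Complex.re_le_norm _)
    simp [pow_two])
  have him := hfour (fun j => (fourierT (q j) x).im) (by
    rw [fourier_sum q hqi]
    refine le_trans (le_of_eq ?_) ((le_abs_self _).trans (Complex.abs_im_le_norm _))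
    simp [pow_two])
  refine ⟨?_, ?_, ?_, ?_⟩
  · have hS0 : 0 ≤ ∑ j, q j x ^ 2 := Finset.sum_nonneg fun _ _ => sq_nonneg _
    have hb := comb_bd h₁ hnm hν hq ho (fun j => q j x)
    have hm := comb_mem hq (fun j => q j x)
    have hx := (key hn hm (by positivity) hb).2 x
    simp only [← pow_two] at hx
    have hx2 := sq_aux (A := 3 * √n / c₁) hS0 (by positivity) (hx.trans (le_of_eq (by ring)))
    refine (hnu _ hm (hb.trans (ENNReal.ofReal_le_ofReal ?_))).trans (ENNReal.ofReal_le_ofReal (by nlinarith))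
    calc (∑ j, q j x ^ 2) / c₁ ≤ (3 * √n / c₁) / c₁ := by gcongr
      _ = 3 / c₁ ^ 2 * √n := by field_simp
      _ ≤ 192 / c₁ ^ 2 * √n := by gcongr; norm_num
      _ ≤ K * √n := by gcongr
  · have hS0 : 0 ≤ ∑ k ∈ Finset.range n, psiH k x ^ 2 := Finset.sum_nonneg fun _ _ => sq_nonneg _
    have hm : (fun y => ∑ k ∈ Finset.range n, psiH k x * psiH k y) ∈ PiH n := by
      have : (fun y => ∑ k ∈ Finset.range n, psiH k x * psiH k y) = ∑ k ∈ Finset.range n, psiH k x • psiH k := by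
        ext y; simp
      rw [this]
      exact Submodule.sum_mem _ fun k hk => (PiH n).smul_mem _ (psi_mem (Finset.mem_range.1 hk))
    have hrep : (fun y => ∑ k ∈ Finset.range n, psiH k x * psiH k y) =
        W (∑ k ∈ Finset.range n, Polynomial.C (psiH k x * gam k) * hP k) := by
      ext y
      rw [W, Polynomial.eval_finsetSum, Finset.sum_mul]
      refine Finset.sum_congr rfl fun k _ => ?_
      rw [congrFun (psiH_eq k) y]
      simp [W]; ring
    have hb : ∫⁻ y, ENNReal.ofReal ((∑ k ∈ Finset.range n, psiH k x * psiH k y) ^ 2) = ENNReal.ofReal (∑ k ∈ Finset.range n, psiH k x ^ 2) := by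
      have := lint_W (∑ k ∈ Finset.range n, Polynomial.C (psiH k x * gam k) * hP k)
      rw [← hrep, I_sq] at this
      rw [this]
      congr 1
      refine Finset.sum_congr rfl fun k _ => ?_
      rw [mul_pow, mul_assoc, gam_sq, mul_one]
    have hx := (key hn hm hS0 hb.le).2 x
    simp only [← pow_two] at hx
    have hx2 := sq_aux hS0 (by positivity) hx
    refine (hnu _ hm (hb.le.trans (ENNReal.ofReal_le_ofReal ?_))).trans (ENNReal.ofReal_le_ofReal (by nlinarith))
    exact hx2.trans (by gcongr)
  · refine (cplx_bd ν _ q hqc hp1 (hnu _ (comb_mem hq _) hre) (hnu _ (comb_mem hq _) him)).trans (ENNReal.ofReal_le_ofReal (by nlinarith))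
  · refine (cplx_bd volume _ q hqc hp2 (hvol _ (comb_mem hq _) hre) (hvol _ (comb_mem hq _) him)).trans (ENNReal.ofReal_le_ofReal (by nlinarith))
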